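/- arXiv:1402.5304 — 8 statements merged into one kernel-verified Lean document; each statement's English description precedes it below -/
import Mathlib

section
/- (Lemma 4.3, explicit solution of the first corrector equation.) For every symmetric positive semidefinite real d×d matrix c (the local quadratic variation of the frictionless optimal strategy), set a := Tr(c·k₂) and let ϖ : ℝ^d → ℝ be the quadratic form ϖ(ξ) := ξᵀk₂ξ, whose gradient is ∇ϖ(ξ) = 2k₂ξ and whose (constant) Hessian is 2k₂. Then for every ξ ∈ ℝ^d the first corrector equation holds: (1/2)·vₓₓ·(ξᵀSξ) − (1/2)·Tr(c·2k₂) + (1/(4vₓ))·(2k₂ξ)ᵀΛ⁻¹(2k₂ξ) + a = 0. -/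
open Matrix

/-- If `M * M = A` with `M` symmetric and `Q * Q = M⁻¹ * S * M⁻¹` with `Q` symmetric, then
`M * Q * M` is a symmetric solution `X` of the quadratic matrix equation `Xᵀ * A⁻¹ * X = S`. -/
theorem transpose_mul_inv_mul_eq_of_sq {n : Type*} [Fintype n] [DecidableEq n]
    {A M Q S : Matrix n n ℝ} (hA : IsUnit A.det) (hM : M.IsSymm) (hMA : M * M = A)
    (hQ : Q.IsSymm) (hQS : Q * Q = M⁻¹ * S * M⁻¹) :
    (M * Q * M)ᵀ * A⁻¹ * (M * Q * M) = S := by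
  have hMu : IsUnit M.det := by
    rw [← hMA, det_mul] at hA
    exact isUnit_of_mul_isUnit_left hA
  have h₁ : M * M⁻¹ = 1 := mul_nonsing_inv M hMu
  have h₂ : M⁻¹ * M = 1 := nonsing_inv_mul M hMu
  calc (M * Q * M)ᵀ * A⁻¹ * (M * Q * M)
      = M * Q * (M * M⁻¹) * (M⁻¹ * M) * Q * M := by
        rw [transpose_mul, transpose_mul, hM.eq, hQ.eq, ← hMA, Matrix.mul_inv_rev]
        simp only [Matrix.mul_assoc]
    _ = M * (Q * Q) * M := by rw [h₁, h₂]; simp only [Matrix.mul_one, Matrix.mul_assoc]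
    _ = (M * M⁻¹) * S * (M⁻¹ * M) := by rw [hQS]; simp only [Matrix.mul_assoc]
    _ = S := by rw [h₁, h₂, Matrix.one_mul, Matrix.mul_one]

/-- Lemma 4.3 (explicit solution of the first corrector equation): for every symmetric
positive semidefinite matrix `c`, setting `a := Tr(c k₂)` and `ϖ(ξ) := ξᵀ k₂ ξ` (whose
gradient is `2 k₂ ξ` and whose Hessian is `2 k₂`), the first corrector equation
`(1/2) vₓₓ ξᵀSξ − (1/2) Tr(c · 2k₂) + (1/(4vₓ)) (2k₂ξ)ᵀ Λ⁻¹ (2k₂ξ) + a = 0` holds. -/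
theorem first_corrector_explicit_solution {d k : ℕ} (hd : 1 ≤ d) (hk : 1 ≤ k)
    (Λ : Matrix (Fin d) (Fin d) ℝ) (hΛsymm : Λ.IsSymm) (hΛ : Λ.PosDef)
    (σ : Matrix (Fin d) (Fin k) ℝ)
    (S : Matrix (Fin d) (Fin d) ℝ) (hS : S = σ * σᵀ)
    (vx vxx : ℝ) (hvx : 0 < vx) (hvxx : vxx < 0)
    (R : ℝ) (hR : R = -vx / vxx)
    (Λh : Matrix (Fin d) (Fin d) ℝ) (hΛhPSD : Λh.PosSemidef) (hΛhsq : Λh * Λh = Λ)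
    (ΛhInv : Matrix (Fin d) (Fin d) ℝ) (hΛhInv : ΛhInv = Λh⁻¹)
    (Q : Matrix (Fin d) (Fin d) ℝ) (hQPSD : Q.PosSemidef)
    (hQsq : Q * Q = ΛhInv * S * ΛhInv)
    (k₂ : Matrix (Fin d) (Fin d) ℝ)
    (hk₂ : k₂ = (vx / Real.sqrt (2 * R)) • (Λh * Q * Λh)) :
    ∀ c : Matrix (Fin d) (Fin d) ℝ, c.IsSymm → c.PosSemidef →
      ∀ ξ : Fin d → ℝ,
        (1 / 2) * vxx * (ξ ⬝ᵥ S.mulVec ξ)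
          - (1 / 2) * (c * ((2 : ℝ) • k₂)).trace
          + (1 / (4 * vx)) *
              (((2 : ℝ) • k₂.mulVec ξ) ⬝ᵥ Λ⁻¹.mulVec ((2 : ℝ) • k₂.mulVec ξ))
          + (c * k₂).trace = 0 := by
  intro c _ _ ξ
  subst hΛhInv
  have hR0 : 0 < R := hR ▸ div_pos_of_neg_of_neg (neg_neg_of_pos hvx) hvxx
  have hcoef : (vx / Real.sqrt (2 * R)) * (vx / Real.sqrt (2 * R)) = -(vx * vxx) / 2 := by
    rw [div_mul_div_comm, Real.mul_self_sqrt (by positivity), hR]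
    have := hvx.ne'
    have := hvxx.ne
    field_simp
  have hk₂S : k₂ᵀ * Λ⁻¹ * k₂ = (-(vx * vxx) / 2) • S := by
    rw [hk₂, transpose_smul, Matrix.smul_mul, Matrix.smul_mul, Matrix.mul_smul, smul_smul, hcoef,
      transpose_mul_inv_mul_eq_of_sq hΛ.det_pos.ne'.isUnit
        (by simpa [IsSymm] using hΛhPSD.isHermitian.eq) hΛhsq
        (by simpa [IsSymm] using hQPSD.isHermitian.eq) hQsq]
  have hquad : k₂.mulVec ξ ⬝ᵥ Λ⁻¹.mulVec (k₂.mulVec ξ)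
      = -(vx * vxx) / 2 * (ξ ⬝ᵥ S.mulVec ξ) := by
    rw [← smul_eq_mul, ← dotProduct_smul, ← smul_mulVec, ← hk₂S, ← mulVec_mulVec,
      ← mulVec_mulVec, dotProduct_mulVec ξ k₂ᵀ, vecMul_transpose]
  rw [mulVec_smul, smul_dotProduct, dotProduct_smul, hquad, Matrix.mul_smul, trace_smul]
  simp only [smul_eq_mul]
  field_simp
  ring
end

section
/- (Exponential change of variables preserves the viscosity subsolution property; part of Lemma 6.8.) Let u : ℝ^d → ℝ be upper semicontinuous and suppose that for every smooth φ : ℝ^d → ℝ and every x₀ ∈ O at which u − φ attains a local maximum, ∇φ(x₀)ᵀA∇φ(x₀) ≤ n(x₀). Then the upper semicontinuous function 𝔲 := −e^{−u} (taking values in (−∞, 0)) is a viscosity subsolution of the transformed equation on O: for every smooth ψ : ℝ^d → ℝ and every x₀ ∈ O at which 𝔲 − ψ attains a local maximum, −n(x₀)·𝔲(x₀)² + ∇ψ(x₀)ᵀA∇ψ(x₀) ≤ 0. -/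
open Matrix

/-- Gradient of a function on `ℝ^d`: the vector of partial derivatives. -/
noncomputable def grad {d : ℕ} (φ : (Fin d → ℝ) → ℝ) (x : Fin d → ℝ) : Fin d → ℝ :=
  fun i => fderiv ℝ φ x (Pi.single i 1)

theorem Real.exp_sub_two_mul_sq_le {s : ℝ} (hs : -(1 / 2) ≤ s) :
    Real.exp (s - 2 * s ^ 2) ≤ 1 + s := by
  have h₁ := Real.add_one_le_exp (-(s - 2 * s ^ 2))
  have h₂ : Real.exp (-(s - 2 * s ^ 2)) * Real.exp (s - 2 * s ^ 2) = 1 := by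
    rw [← Real.exp_add]; simp
  have h₃ : 1 ≤ (1 + s) * Real.exp (-(s - 2 * s ^ 2)) := by
    nlinarith [mul_le_mul_of_nonneg_left h₁ (by linarith : 0 ≤ 1 + s),
      mul_nonneg (sq_nonneg s) (by linarith : 0 ≤ 1 + 2 * s)]
  nlinarith [mul_le_mul_of_nonneg_right h₃ (Real.exp_pos (s - 2 * s ^ 2)).le]

/-- A quadratic polynomial in `ψ` has gradient at `x₀` equal to the rescaled gradient of `ψ`. -/
theorem grad_quadratic_comp {d : ℕ} {ψ : (Fin d → ℝ) → ℝ} {x₀ : Fin d → ℝ}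
    (hψ : DifferentiableAt ℝ ψ x₀) (a e : ℝ) :
    grad (fun x => a - (ψ x₀ - ψ x) * e + 2 * ((ψ x₀ - ψ x) * e) ^ 2) x₀ = e • grad ψ x₀ := by
  have h₁ : HasFDerivAt (fun x => (ψ x₀ - ψ x) * e) (e • -fderiv ℝ ψ x₀) x₀ :=
    (hψ.hasFDerivAt.const_sub (ψ x₀)).mul_const e
  have h₂ := (h₁.const_sub a).add ((h₁.pow 2).const_mul 2)
  ext i
  unfold grad
  erw [h₂.fderiv]
  simp

/-- Part of Lemma 6.8: if `u` is an upper semicontinuous viscosity subsolution of the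
Eikonal equation `(∇u)ᵀA∇u = n` on `O`, then `𝔲 := −e^{−u}` is an upper semicontinuous
viscosity subsolution of the transformed equation `−n·𝔲² + (∇𝔲)ᵀA∇𝔲 = 0` on `O`. -/
theorem exp_transform_preserves_subsolution {d : ℕ} (hd : 1 ≤ d)
    (O : Set (Fin d → ℝ)) (n : (Fin d → ℝ) → ℝ)
    (A : Matrix (Fin d) (Fin d) ℝ) (hAsymm : A.IsSymm) (hA : A.PosSemidef)
    (u : (Fin d → ℝ) → ℝ) (husc : UpperSemicontinuous u)
    (hsub : ∀ φ : (Fin d → ℝ) → ℝ, ContDiff ℝ (⊤ : ℕ∞) φ →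
      ∀ x₀ ∈ O, IsLocalMax (fun x => u x - φ x) x₀ →
        grad φ x₀ ⬝ᵥ A.mulVec (grad φ x₀) ≤ n x₀)
    (w : (Fin d → ℝ) → ℝ) (hw : ∀ x, w x = -Real.exp (-u x)) :
    UpperSemicontinuous w ∧ (∀ x, w x < 0) ∧
    ∀ ψ : (Fin d → ℝ) → ℝ, ContDiff ℝ (⊤ : ℕ∞) ψ →
      ∀ x₀ ∈ O, IsLocalMax (fun x => w x - ψ x) x₀ →
        -n x₀ * w x₀ ^ 2 + grad ψ x₀ ⬝ᵥ A.mulVec (grad ψ x₀) ≤ 0 := by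
  refine ⟨?_, fun x => by rw [hw]; exact neg_neg_of_pos (Real.exp_pos _), ?_⟩
  · have hmono : Monotone fun t : ℝ => -Real.exp (-t) := fun a b hab =>
      neg_le_neg (Real.exp_le_exp.2 (neg_le_neg hab))
    have hcont : Continuous fun t : ℝ => -Real.exp (-t) := by fun_prop
    rw [funext hw]
    exact hcont.comp_upperSemicontinuous husc hmono
  · intro ψ hψ x₀ hx₀ hmax
    set e := Real.exp (u x₀) with he
    have hwe : w x₀ * e = -1 := by
      rw [hw, he, neg_mul, ← Real.exp_add]; simp
    have hnear : ∀ᶠ x in nhds x₀, -(1 / 2) < (ψ x₀ - ψ x) * e := by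
      have hc : Continuous fun x => (ψ x₀ - ψ x) * e :=
        (continuous_const.sub hψ.continuous).mul continuous_const
      exact hc.continuousAt.eventually_const_lt (by norm_num)
    have key := hsub (fun x => u x₀ - (ψ x₀ - ψ x) * e + 2 * ((ψ x₀ - ψ x) * e) ^ 2)
      (by fun_prop) x₀ hx₀ (by
        filter_upwards [hmax, hnear] with x hx hs
        have hexp := Real.exp_sub_two_mul_sq_le hs.le
        have hle : 1 + (ψ x₀ - ψ x) * e ≤ Real.exp (u x₀ - u x) := by
          rw [sub_eq_add_neg (u x₀) (u x), Real.exp_add, ← he]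
          rw [hw x] at hx
          have := mul_le_mul_of_nonneg_right hx (Real.exp_pos (u x₀)).le
          rw [← he] at this
          linarith
        have := Real.exp_le_exp.1 (hexp.trans hle)
        simp only [sub_self, zero_mul]
        linarith)
    rw [grad_quadratic_comp (hψ.differentiable (by simp)).differentiableAt, mulVec_smul,
      smul_dotProduct, dotProduct_smul, smul_eq_mul, smul_eq_mul] at key
    have hmul := mul_le_mul_of_nonneg_right key (sq_nonneg (w x₀))
    have hsq : (w x₀ * e) ^ 2 = 1 := by rw [hwe]; norm_num
    have hQ : e * (e * (grad ψ x₀ ⬝ᵥ A.mulVec (grad ψ x₀))) * w x₀ ^ 2 =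
        grad ψ x₀ ⬝ᵥ A.mulVec (grad ψ x₀) := by
      linear_combination (grad ψ x₀ ⬝ᵥ A.mulVec (grad ψ x₀)) * hsq
    linarith
end

section
/- (Exponential change of variables preserves the viscosity supersolution property; part of Lemma 6.8.) Let u : ℝ^d → ℝ be lower semicontinuous and suppose that for every smooth φ : ℝ^d → ℝ and every x₀ ∈ O at which u − φ attains a local minimum, ∇φ(x₀)ᵀA∇φ(x₀) ≥ n(x₀). Then the lower semicontinuous function 𝔲 := −e^{−u} (taking values in (−∞, 0)) is a viscosity supersolution of the transformed equation on O: for every smooth ψ : ℝ^d → ℝ and every x₀ ∈ O at which 𝔲 − ψ attains a local minimum, −n(x₀)·𝔲(x₀)² + ∇ψ(x₀)ᵀA∇ψ(x₀) ≥ 0. -/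
open Matrix

theorem grad_const_mul {d : ℕ} {φ : (Fin d → ℝ) → ℝ} {x : Fin d → ℝ}
    (hφ : DifferentiableAt ℝ φ x) (c : ℝ) :
    grad (fun y => c * φ y) x = c • grad φ x := by
  ext i
  simp [grad, fderiv_const_mul hφ c]

/-- If `-exp (-u) - ψ` has a local minimum at `x₀`, then so does `u - exp (u x₀) * ψ`. -/
theorem IsLocalMin.sub_exp_mul_of_neg_exp_neg_sub {X : Type*} [TopologicalSpace X]
    {u ψ : X → ℝ} {x₀ : X} (h : IsLocalMin (fun x => -Real.exp (-u x) - ψ x) x₀) :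
    IsLocalMin (fun x => u x - Real.exp (u x₀) * ψ x) x₀ := by
  filter_upwards [h] with x hx
  have h₁ : Real.exp (u x₀) * Real.exp (-u x₀) = 1 := by simp [← Real.exp_add]
  have h₂ : Real.exp (u x₀) * Real.exp (-u x) = Real.exp (u x₀ - u x) := by
    rw [← Real.exp_add, sub_eq_add_neg]
  have h₃ := Real.add_one_le_exp (u x₀ - u x)
  have h₄ := mul_le_mul_of_nonneg_left hx (Real.exp_pos (u x₀)).le
  linarith

/-- Part of Lemma 6.8: if `u` is a lower semicontinuous viscosity supersolution of the
Eikonal equation `(∇u)ᵀA∇u = n` on `O`, then `𝔲 := −e^{−u}` is a lower semicontinuous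
viscosity supersolution of the transformed equation `−n·𝔲² + (∇𝔲)ᵀA∇𝔲 = 0` on `O`. -/
theorem exp_transform_preserves_supersolution {d : ℕ} (hd : 1 ≤ d)
    (O : Set (Fin d → ℝ)) (n : (Fin d → ℝ) → ℝ)
    (A : Matrix (Fin d) (Fin d) ℝ) (hAsymm : A.IsSymm) (hA : A.PosSemidef)
    (u : (Fin d → ℝ) → ℝ) (hlsc : LowerSemicontinuous u)
    (hsuper : ∀ φ : (Fin d → ℝ) → ℝ, ContDiff ℝ (⊤ : ℕ∞) φ →
      ∀ x₀ ∈ O, IsLocalMin (fun x => u x - φ x) x₀ →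
        n x₀ ≤ grad φ x₀ ⬝ᵥ A.mulVec (grad φ x₀))
    (w : (Fin d → ℝ) → ℝ) (hw : ∀ x, w x = -Real.exp (-u x)) :
    LowerSemicontinuous w ∧ (∀ x, w x < 0) ∧
    ∀ ψ : (Fin d → ℝ) → ℝ, ContDiff ℝ (⊤ : ℕ∞) ψ →
      ∀ x₀ ∈ O, IsLocalMin (fun x => w x - ψ x) x₀ →
        0 ≤ -n x₀ * w x₀ ^ 2 + grad ψ x₀ ⬝ᵥ A.mulVec (grad ψ x₀) := by
  obtain rfl : w = fun x => -Real.exp (-u x) := funext hw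
  refine ⟨?_, fun x => neg_lt_zero.mpr (Real.exp_pos _), fun ψ hψ x₀ hx₀ hmin => ?_⟩
  · have hmono : Monotone fun t : ℝ => -Real.exp (-t) := fun a b hab =>
      neg_le_neg (Real.exp_le_exp.mpr (neg_le_neg hab))
    have hcont : Continuous fun t : ℝ => -Real.exp (-t) := by fun_prop
    exact hcont.comp_lowerSemicontinuous hlsc hmono
  · have hn := hsuper (fun x => Real.exp (u x₀) * ψ x) (contDiff_const.mul hψ) x₀ hx₀
      hmin.sub_exp_mul_of_neg_exp_neg_sub
    rw [grad_const_mul (hψ.differentiable (by simp) x₀), mulVec_smul, smul_dotProduct,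
      dotProduct_smul, smul_eq_mul, smul_eq_mul] at hn
    have h₁ : Real.exp (-u x₀) * Real.exp (u x₀) = 1 := by simp [← Real.exp_add]
    have h₂ := mul_le_mul_of_nonneg_left hn (sq_nonneg (Real.exp (-u x₀)))
    have h₃ (G : ℝ) :
        Real.exp (-u x₀) ^ 2 * (Real.exp (u x₀) * (Real.exp (u x₀) * G)) = G := by
      linear_combination G * (Real.exp (-u x₀) * Real.exp (u x₀) + 1) * h₁
    rw [h₃] at h₂
    linarith
end

section
/- (Explicit classical solution of the transformed Eikonal equation; part of Lemma 6.8.) Fix θ⁰ ∈ ℝ^d and a constant C ∈ ℝ. Define n : ℝ^d → ℝ by n(ϑ) := −2·vₓ·vₓₓ·(ϑ−θ⁰)ᵀS(ϑ−θ⁰) and 𝔲 : ℝ^d → ℝ by 𝔲(ϑ) := −exp(−(C + (ϑ−θ⁰)ᵀk₂(ϑ−θ⁰))). Then 𝔲 is differentiable and is a classical solution on all of ℝ^d of the transformed Eikonal equation: −n(ϑ)·𝔲(ϑ)² + ∇𝔲(ϑ)ᵀΛ⁻¹∇𝔲(ϑ) = 0 for every ϑ ∈ ℝ^d. -/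
open Matrix

theorem differentiable_quadForm_sub {d : ℕ} (M : Matrix (Fin d) (Fin d) ℝ) (a : Fin d → ℝ) :
    Differentiable ℝ fun x : Fin d → ℝ => (x - a) ⬝ᵥ M.mulVec (x - a) := by
  simp only [dotProduct, mulVec, Pi.sub_apply]
  fun_prop

theorem fderiv_quadForm_sub {d : ℕ} {M : Matrix (Fin d) (Fin d) ℝ} (hM : M.IsSymm)
    (a x v : Fin d → ℝ) :
    fderiv ℝ (fun x : Fin d → ℝ => (x - a) ⬝ᵥ M.mulVec (x - a)) x v =
      2 * (v ⬝ᵥ M.mulVec (x - a)) := by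
  have h := ((differentiable_quadForm_sub M a x).hasFDerivAt.hasLineDerivAt v)
  refine HasDerivAt.unique h ?_
  have hsymm : (x - a) ⬝ᵥ M.mulVec v = v ⬝ᵥ M.mulVec (x - a) := by
    rw [dotProduct_mulVec, ← mulVec_transpose, hM.eq, dotProduct_comm]
  have hexp : (fun t : ℝ => (x + t • v - a) ⬝ᵥ M.mulVec (x + t • v - a)) = fun t =>
      (x - a) ⬝ᵥ M.mulVec (x - a) + t * (2 * (v ⬝ᵥ M.mulVec (x - a)))
        + t ^ 2 * (v ⬝ᵥ M.mulVec v) := by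
    funext t
    rw [show x + t • v - a = (x - a) + t • v by abel]
    simp only [mulVec_add, mulVec_smul, add_dotProduct, dotProduct_add, smul_dotProduct,
      dotProduct_smul, smul_eq_mul, hsymm]
    ring
  rw [hexp]
  have h₁ := (((hasDerivAt_id (0 : ℝ)).mul_const (2 * (v ⬝ᵥ M.mulVec (x - a)))).const_add
    ((x - a) ⬝ᵥ M.mulVec (x - a))).add
    (((hasDerivAt_id (0 : ℝ)).pow 2).mul_const (v ⬝ᵥ M.mulVec v))
  refine (h₁.congr_deriv (by simp)).congr_of_eventuallyEq (.of_forall fun t => ?_)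
  simp

theorem grad_neg_exp_neg_quadForm {d : ℕ} {M : Matrix (Fin d) (Fin d) ℝ} (hM : M.IsSymm)
    (C : ℝ) (a x : Fin d → ℝ) :
    grad (fun x => -Real.exp (-(C + (x - a) ⬝ᵥ M.mulVec (x - a)))) x =
      (2 * Real.exp (-(C + (x - a) ⬝ᵥ M.mulVec (x - a)))) • M.mulVec (x - a) := by
  have h := (((differentiable_quadForm_sub M a x).hasFDerivAt.const_add C).neg.exp).neg
  funext i
  simp only [grad]
  refine (congrArg (fun L => L (Pi.single i 1)) (HasFDerivAt.fderiv h)).trans ?_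
  simp only [_root_.neg_apply, _root_.smul_apply, fderiv_quadForm_sub hM,
    single_one_dotProduct, Pi.smul_apply, Pi.neg_apply, smul_eq_mul]
  ring

/-- Part of Lemma 6.8: the function `𝔲(ϑ) = −exp(−(C + (ϑ−θ⁰)ᵀ k₂ (ϑ−θ⁰)))` is a classical
solution on all of `ℝ^d` of the transformed Eikonal equation
`−n(ϑ) 𝔲(ϑ)² + ∇𝔲(ϑ)ᵀ Λ⁻¹ ∇𝔲(ϑ) = 0`, where
`n(ϑ) = −2 vₓ vₓₓ (ϑ−θ⁰)ᵀ S (ϑ−θ⁰)`. -/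
theorem transformed_eikonal_classical_solution {d k : ℕ} (hd : 1 ≤ d) (hk : 1 ≤ k)
    (Λ : Matrix (Fin d) (Fin d) ℝ) (hΛsymm : Λ.IsSymm) (hΛ : Λ.PosDef)
    (σ : Matrix (Fin d) (Fin k) ℝ)
    (S : Matrix (Fin d) (Fin d) ℝ) (hS : S = σ * σᵀ)
    (vx vxx : ℝ) (hvx : 0 < vx) (hvxx : vxx < 0)
    (R : ℝ) (hR : R = -vx / vxx)
    (Λh : Matrix (Fin d) (Fin d) ℝ) (hΛhPSD : Λh.PosSemidef) (hΛhsq : Λh * Λh = Λ)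
    (ΛhInv : Matrix (Fin d) (Fin d) ℝ) (hΛhInv : ΛhInv = Λh⁻¹)
    (Q : Matrix (Fin d) (Fin d) ℝ) (hQPSD : Q.PosSemidef)
    (hQsq : Q * Q = ΛhInv * S * ΛhInv)
    (k₂ : Matrix (Fin d) (Fin d) ℝ)
    (hk₂ : k₂ = (vx / Real.sqrt (2 * R)) • (Λh * Q * Λh))
    (θ₀ : Fin d → ℝ) (C : ℝ)
    (n : (Fin d → ℝ) → ℝ)
    (hn : ∀ ϑ, n ϑ = -2 * vx * vxx * ((ϑ - θ₀) ⬝ᵥ S.mulVec (ϑ - θ₀)))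
    (w : (Fin d → ℝ) → ℝ)
    (hw : ∀ ϑ, w ϑ = -Real.exp (-(C + (ϑ - θ₀) ⬝ᵥ k₂.mulVec (ϑ - θ₀)))) :
    Differentiable ℝ w ∧
    ∀ ϑ : Fin d → ℝ,
      -n ϑ * w ϑ ^ 2 + grad w ϑ ⬝ᵥ Λ⁻¹.mulVec (grad w ϑ) = 0 := by
  have hdet : IsUnit Λh.det := by
    have h := hΛ.isUnit.map detMonoidHom
    rw [← hΛhsq, map_mul] at h
    exact isUnit_of_mul_isUnit_left h
  have hΛhT : Λhᵀ = Λh := by simpa using hΛhPSD.isHermitian.eq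
  have hQT : Qᵀ = Q := by simpa using hQPSD.isHermitian.eq
  have hk₂symm : k₂.IsSymm := by
    rw [IsSymm, hk₂, transpose_smul, transpose_mul, transpose_mul, hΛhT, hQT, Matrix.mul_assoc]
  have hw' : w = fun ϑ => -Real.exp (-(C + (ϑ - θ₀) ⬝ᵥ k₂.mulVec (ϑ - θ₀))) := funext hw
  have hsandwich : (Λh * Q * Λh) * Λ⁻¹ * (Λh * Q * Λh) = S := by
    calc (Λh * Q * Λh) * Λ⁻¹ * (Λh * Q * Λh)
        = Λh * Q * (Λh * Λh⁻¹) * (Λh⁻¹ * Λh) * Q * Λh := by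
          rw [← hΛhsq, Matrix.mul_inv_rev]
          simp only [Matrix.mul_assoc]
      _ = Λh * (Q * Q) * Λh := by
          rw [mul_nonsing_inv _ hdet, nonsing_inv_mul _ hdet]
          simp only [Matrix.mul_assoc, Matrix.one_mul]
      _ = (Λh * Λh⁻¹) * S * (Λh⁻¹ * Λh) := by
          rw [hQsq, hΛhInv]
          simp only [Matrix.mul_assoc]
      _ = S := by
          rw [mul_nonsing_inv _ hdet, nonsing_inv_mul _ hdet, Matrix.one_mul, Matrix.mul_one]
  have hRpos : 0 < R := by
    rw [hR]
    exact div_pos_of_neg_of_neg (neg_lt_zero.mpr hvx) hvxx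
  have hcoef : (vx / Real.sqrt (2 * R)) * (vx / Real.sqrt (2 * R)) = -(vx * vxx) / 2 := by
    rw [div_mul_div_comm, Real.mul_self_sqrt (by positivity), hR]
    field_simp
  have hkk : k₂ * Λ⁻¹ * k₂ = (-(vx * vxx) / 2) • S := by
    rw [hk₂, Matrix.smul_mul, Matrix.smul_mul, Matrix.mul_smul, smul_smul, hsandwich, hcoef]
  refine ⟨?_, fun ϑ => ?_⟩
  · rw [hw']
    exact (((differentiable_quadForm_sub k₂ θ₀).const_add C).neg.exp).neg
  · have hquad : k₂.mulVec (ϑ - θ₀) ⬝ᵥ Λ⁻¹.mulVec (k₂.mulVec (ϑ - θ₀)) =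
        -(vx * vxx) / 2 * ((ϑ - θ₀) ⬝ᵥ S.mulVec (ϑ - θ₀)) := by
      rw [← smul_eq_mul, ← dotProduct_smul, ← smul_mulVec, ← hkk, ← mulVec_mulVec,
        ← mulVec_mulVec, dotProduct_mulVec (ϑ - θ₀) k₂, ← mulVec_transpose, hk₂symm.eq]
    rw [hn, hw', grad_neg_exp_neg_quadForm hk₂symm, mulVec_smul, smul_dotProduct,
      dotProduct_smul, hquad]
    simp only [smul_eq_mul]
    ring
end

section
/- (Lemma 6.6, supersolution restriction to a slice.) Let u : ℝ^m × ℝ^d → ℝ be lower semicontinuous and locally bounded from below. Suppose that for every smooth ψ : ℝ^m × ℝ^d → ℝ and every point (ζ̄, ϑ̄) at which u − ψ attains a local minimum, one has ∇_ϑψ(ζ̄, ϑ̄)ᵀ A(ζ̄) ∇_ϑψ(ζ̄, ϑ̄) ≥ n(ζ̄, ϑ̄). Then for every fixed ζ₀ ∈ ℝ^m the slice ϑ ↦ u(ζ₀, ϑ) is a viscosity supersolution of the frozen Eikonal equation: for every smooth φ : ℝ^d → ℝ and every ϑ₀ at which u(ζ₀, ·) − φ attains a local minimum, ∇φ(ϑ₀)ᵀ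 A(ζ₀) ∇φ(ϑ₀) ≥ n(ζ₀, ϑ₀). -/
open Matrix

/-- Partial gradient in the second block of variables `ϑ` of a function on `ℝ^m × ℝ^d`. -/
noncomputable def gradSnd {m d : ℕ} (ψ : (Fin m → ℝ) × (Fin d → ℝ) → ℝ)
    (p : (Fin m → ℝ) × (Fin d → ℝ)) : Fin d → ℝ :=
  fun i => fderiv ℝ (fun y => ψ (p.1, y)) p.2 (Pi.single i 1)

/-- Penalization: if `w` is lower semicontinuous and has a strict minimum at `x₀` along the zero
set of `g ≥ 0` within a closed ball, then `w + k g` has, for some `k`, a local minimum in that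
ball. -/
theorem exists_isLocalMin_add_mul_penalty {X : Type*} [MetricSpace X] [ProperSpace X]
    {w g : X → ℝ} (hw : LowerSemicontinuous w) (hg : Continuous g) (hg0 : ∀ x, 0 ≤ g x)
    {x₀ : X} (hgx₀ : g x₀ = 0) {r : ℝ} (hr : 0 < r)
    (hstrict : ∀ x ∈ Metric.closedBall x₀ r, x ≠ x₀ → g x = 0 → w x₀ < w x) :
    ∃ k : ℝ, ∃ x ∈ Metric.ball x₀ r, IsLocalMin (fun y => w y + k * g y) x := by
  have hlsc : ∀ k : ℕ, LowerSemicontinuous fun y => w y + (k : ℝ) * g y := fun k =>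
    hw.add (continuous_const.mul hg).lowerSemicontinuous
  obtain ⟨k, hk⟩ : ∃ k : ℕ, Metric.sphere x₀ r ⊆ {y | w x₀ < w y + (k : ℝ) * g y} := by
    refine (isCompact_sphere x₀ r).elim_directed_cover
      (fun k : ℕ => {y | w x₀ < w y + (k : ℝ) * g y}) (fun k => (hlsc k).isOpen_preimage (w x₀))
      (fun y hy => ?_) (Monotone.directed_le fun a b hab y hy => ?_)
    · rw [Set.mem_iUnion]
      rcases (hg0 y).eq_or_lt with h | h
      · refine ⟨0, ?_⟩
        have := hstrict y (Metric.sphere_subset_closedBall hy) (Metric.ne_of_mem_sphere hy hr.ne')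
          h.symm
        simpa using this
      · obtain ⟨k, hk⟩ := exists_nat_gt ((w x₀ - w y) / g y)
        rw [div_lt_iff₀ h] at hk
        exact ⟨k, by rw [Set.mem_ofPred_eq]; linarith⟩
    · have : (a : ℝ) * g y ≤ b * g y :=
        mul_le_mul_of_nonneg_right (Nat.cast_le.mpr hab) (hg0 y)
      rw [Set.mem_ofPred_eq] at hy ⊢
      linarith
  obtain ⟨x, hx, hmin⟩ := (hlsc k).lowerSemicontinuousOn _ |>.exists_isMinOn
    (Metric.nonempty_closedBall.mpr hr.le) (isCompact_closedBall x₀ r)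
  have hxball : x ∈ Metric.ball x₀ r := by
    refine Metric.mem_ball.mpr (lt_of_le_of_ne (Metric.mem_closedBall.mp hx) fun h => ?_)
    have h₁ := hk (Metric.mem_sphere.mpr h)
    have h₂ := isMinOn_iff.mp hmin x₀ (Metric.mem_closedBall_self hr.le)
    rw [Set.mem_ofPred_eq] at h₁
    simp only [hgx₀, mul_zero, add_zero] at h₂
    exact absurd h₁ h₂.not_gt
  exact ⟨k, x, hxball, hmin.isLocalMin
    (Filter.mem_of_superset (Metric.isOpen_ball.mem_nhds hxball) Metric.ball_subset_closedBall)⟩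

theorem sum_sub_sq_nonneg {k : ℕ} (a x : Fin k → ℝ) : 0 ≤ ∑ i, (x i - a i) ^ 2 :=
  Finset.sum_nonneg fun _ _ => sq_nonneg _

theorem sum_sub_sq_eq_zero_iff {k : ℕ} (a x : Fin k → ℝ) :
    ∑ i, (x i - a i) ^ 2 = 0 ↔ x = a := by
  rw [Finset.sum_eq_zero_iff_of_nonneg fun _ _ => sq_nonneg _]
  simp [funext_iff, sub_eq_zero]

theorem contDiff_sum_sub_sq {k : ℕ} (a : Fin k → ℝ) :
    ContDiff ℝ (⊤ : ℕ∞) fun x : Fin k → ℝ => ∑ i, (x i - a i) ^ 2 := by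
  fun_prop

theorem continuous_grad {d : ℕ} {φ : (Fin d → ℝ) → ℝ} (hφ : ContDiff ℝ (⊤ : ℕ∞) φ) :
    Continuous (grad φ) :=
  continuous_pi fun _ => (hφ.continuous_fderiv (by simp)).clm_apply continuous_const

/-- Subtracting the squared distance to `a` does not change the gradient at `a`. -/
theorem grad_sub_sum_sub_sq {d : ℕ} {φ : (Fin d → ℝ) → ℝ} (hφ : ContDiff ℝ (⊤ : ℕ∞) φ)
    (a : Fin d → ℝ) : grad (fun x => φ x - ∑ i, (x i - a i) ^ 2) a = grad φ a := by
  have hmin : IsLocalMin (fun x : Fin d → ℝ => ∑ i, (x i - a i) ^ 2) a :=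
    Filter.Eventually.of_forall fun x => by simpa using sum_sub_sq_nonneg a x
  funext j
  simp only [grad]
  rw [fderiv_fun_sub (hφ.differentiable (by simp) a)
    ((contDiff_sum_sub_sq a).differentiable (by simp) a), hmin.fderiv_eq_zero, sub_zero]

theorem gradSnd_comp_snd_sub_comp_fst {m d : ℕ} (φ : (Fin d → ℝ) → ℝ) (g : (Fin m → ℝ) → ℝ)
    (p : (Fin m → ℝ) × (Fin d → ℝ)) : gradSnd (fun q => φ q.2 - g q.1) p = grad φ p.2 := by
  funext j
  simp only [gradSnd, grad, fderiv_sub_const]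

/-- Lemma 6.6 (supersolution restriction to a slice): if the lower semicontinuous, locally
bounded from below function `u(ζ,ϑ)` is a viscosity supersolution of
`(∇_ϑ u)ᵀ A(ζ) ∇_ϑ u ≥ n(ζ,ϑ)`, then for every fixed `ζ₀` the slice `ϑ ↦ u(ζ₀,ϑ)` is a
viscosity supersolution of the frozen Eikonal equation. -/
theorem eikonal_supersolution_slice {m d : ℕ} (hm : 1 ≤ m) (hd : 1 ≤ d)
    (n : (Fin m → ℝ) × (Fin d → ℝ) → ℝ) (hn : Continuous n)
    (A : (Fin m → ℝ) → Matrix (Fin d) (Fin d) ℝ) (hA : Continuous A)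
    (hAsymm : ∀ ζ, (A ζ).IsSymm)
    (u : (Fin m → ℝ) × (Fin d → ℝ) → ℝ) (hlsc : LowerSemicontinuous u)
    (hlocbdd : ∀ p : (Fin m → ℝ) × (Fin d → ℝ),
      ∃ s ∈ nhds p, BddBelow (u '' s))
    (hsuper : ∀ ψ : (Fin m → ℝ) × (Fin d → ℝ) → ℝ, ContDiff ℝ (⊤ : ℕ∞) ψ →
      ∀ p : (Fin m → ℝ) × (Fin d → ℝ), IsLocalMin (fun q => u q - ψ q) p →
        n p ≤ gradSnd ψ p ⬝ᵥ (A p.1).mulVec (gradSnd ψ p)) :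
    ∀ ζ₀ : Fin m → ℝ, ∀ φ : (Fin d → ℝ) → ℝ, ContDiff ℝ (⊤ : ℕ∞) φ →
      ∀ ϑ₀ : Fin d → ℝ, IsLocalMin (fun ϑ => u (ζ₀, ϑ) - φ ϑ) ϑ₀ →
        n (ζ₀, ϑ₀) ≤ grad φ ϑ₀ ⬝ᵥ (A ζ₀).mulVec (grad φ ϑ₀) := by
  intro ζ₀ φ hφ ϑ₀ hmin
  set φ' : (Fin d → ℝ) → ℝ := fun x => φ x - ∑ i, (x i - ϑ₀ i) ^ 2 with hφ'_def
  have hφ' : ContDiff ℝ (⊤ : ℕ∞) φ' := hφ.sub (contDiff_sum_sub_sq ϑ₀)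
  have hgrad : grad φ' ϑ₀ = grad φ ϑ₀ := grad_sub_sum_sub_sq hφ ϑ₀
  rw [← hgrad]
  by_contra! hlt
  have hcont : Continuous fun p : (Fin m → ℝ) × (Fin d → ℝ) =>
      grad φ' p.2 ⬝ᵥ (A p.1).mulVec (grad φ' p.2) := by
    have h := (continuous_grad hφ').comp (continuous_snd (X := Fin m → ℝ))
    exact h.dotProduct ((hA.comp continuous_fst).matrix_mulVec h)
  have hnear : ∀ᶠ p in nhds (ζ₀, ϑ₀),
      grad φ' p.2 ⬝ᵥ (A p.1).mulVec (grad φ' p.2) < n p :=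
    hcont.continuousAt.eventually_lt hn.continuousAt hlt
  obtain ⟨r₁, hr₁, hball₁⟩ := Metric.eventually_nhds_iff_ball.mp hnear
  obtain ⟨r₂, hr₂, hball₂⟩ := Metric.eventually_nhds_iff_ball.mp hmin
  have hr : 0 < min r₁ (r₂ / 2) := lt_min hr₁ (half_pos hr₂)
  have hw : LowerSemicontinuous fun q : (Fin m → ℝ) × (Fin d → ℝ) => u q + -φ' q.2 :=
    hlsc.add (hφ'.continuous.comp continuous_snd).neg.lowerSemicontinuous
  obtain ⟨k, p, hp, hpmin⟩ := exists_isLocalMin_add_mul_penalty hw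
    (g := fun q => ∑ i, (q.1 i - ζ₀ i) ^ 2) (by fun_prop)
    (fun q => sum_sub_sq_nonneg ζ₀ q.1) (x₀ := (ζ₀, ϑ₀)) (by simp) hr (by
      rintro ⟨ζ, ϑ⟩ hq hne hζ
      obtain rfl : ζ = ζ₀ := (sum_sub_sq_eq_zero_iff _ _).mp hζ
      have hϑ : ϑ ≠ ϑ₀ := fun h => hne (by rw [h])
      have hpos : 0 < ∑ i, (ϑ i - ϑ₀ i) ^ 2 := (sum_sub_sq_nonneg ϑ₀ ϑ).lt_of_ne'
        fun h => hϑ ((sum_sub_sq_eq_zero_iff _ _).mp h)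
      have hdist : dist ϑ ϑ₀ ≤ min r₁ (r₂ / 2) := (le_max_right _ _).trans hq
      have hle := hball₂ ϑ (Metric.mem_ball.mpr
        ((hdist.trans (min_le_right _ _)).trans_lt (half_lt_self hr₂)))
      have hzero : ∑ i, (ϑ₀ i - ϑ₀ i) ^ 2 = 0 := by simp
      simp only [hφ'_def]
      linarith)
  have hle := hsuper (fun q => φ' q.2 - k * ∑ i, (q.1 i - ζ₀ i) ^ 2)
    ((hφ'.comp contDiff_snd).sub
      (contDiff_const.mul ((contDiff_sum_sub_sq ζ₀).comp contDiff_fst))) p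
    (by
      refine (congrArg (IsLocalMin · p) (funext fun q => ?_)).mpr hpmin
      ring)
  rw [gradSnd_comp_snd_sub_comp_fst φ' (fun ζ => k * ∑ i, (ζ i - ζ₀ i) ^ 2)] at hle
  exact hle.not_gt (hball₁ p (Metric.ball_subset_ball (min_le_left _ _) hp))
end

section
/- (Comparison for the second corrector equation via a strict Lyapunov function; Step 2 of the proof of Proposition 7.2.) Assume: (i) there is a nonnegative C^{1,2} function χ : [0,T]×ℝ^N → [0,∞) with −ℒχ > 0 at every point of [0,T)×ℝ^N; (ii) ũ : [0,T]×ℝ^N → ℝ is a C^{1,2} classical solution of −ℒũ = a on [0,T)×ℝ^N; (iii) u₁ : [0,T]×ℝ^N → ℝ is lower semicontinuous and is a viscosity supersolution: for every C^{1,2} function ψ and every (t₀,z₀) ∈ [0,T)×ℝ^N at which u₁ − ψ attains a local minimum (relative to [0,T]×ℝ^N), one has −ℒψ(t₀,z₀) ≥ a(t₀,z₀); (iv) growth condition: for every δ > 0 there exists r > 0 such that |u₁(t,z)| + |ũ(t,z)| ≤ δ(1 + χ(t,z)) whenever |z| ≥ r; (v) u₁(T, z) ≥ ũ(T, z) for all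 z ∈ ℝ^N. Then u₁ ≥ ũ on all of [0,T]×ℝ^N. -/
open Matrix

/-- Time partial derivative of a function of `(t, z) ∈ ℝ × ℝ^N`. -/
noncomputable def dtPar {N : ℕ} (φ : ℝ × (Fin N → ℝ) → ℝ) (p : ℝ × (Fin N → ℝ)) : ℝ :=
  deriv (fun s => φ (s, p.2)) p.1

/-- Spatial gradient of a function of `(t, z) ∈ ℝ × ℝ^N`. -/
noncomputable def gradZ {N : ℕ} (φ : ℝ × (Fin N → ℝ) → ℝ) (p : ℝ × (Fin N → ℝ)) :
    Fin N → ℝ :=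
  fun i => fderiv ℝ (fun y => φ (p.1, y)) p.2 (Pi.single i 1)

/-- Spatial Hessian matrix of a function of `(t, z) ∈ ℝ × ℝ^N`. -/
noncomputable def hessZ {N : ℕ} (φ : ℝ × (Fin N → ℝ) → ℝ) (p : ℝ × (Fin N → ℝ)) :
    Matrix (Fin N) (Fin N) ℝ :=
  Matrix.of fun i j =>
    fderiv ℝ (fun y => fderiv ℝ (fun y' => φ (p.1, y')) y (Pi.single j 1)) p.2 (Pi.single i 1)

/-- `φ` is of class `C^{1,2}`: continuous, once continuously differentiable in `t` and
twice continuously differentiable in `z`, with jointly continuous derivatives. -/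
def IsC12 {N : ℕ} (φ : ℝ × (Fin N → ℝ) → ℝ) : Prop :=
  Continuous φ ∧
  (∀ z : Fin N → ℝ, Differentiable ℝ (fun s => φ (s, z))) ∧
  Continuous (dtPar φ) ∧
  (∀ t : ℝ, ContDiff ℝ 2 (fun y => φ (t, y))) ∧
  Continuous (gradZ φ) ∧
  Continuous (hessZ φ)

/-- The parabolic operator `ℒφ = ∂ₜφ + ⟨b, ∇_zφ⟩ + (1/2) Tr(A · D²_zφ)`. -/
noncomputable def Lop {N : ℕ} (b : ℝ × (Fin N → ℝ) → Fin N → ℝ)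
    (A : ℝ × (Fin N → ℝ) → Matrix (Fin N) (Fin N) ℝ)
    (φ : ℝ × (Fin N → ℝ) → ℝ) (p : ℝ × (Fin N → ℝ)) : ℝ :=
  dtPar φ p + b p ⬝ᵥ gradZ φ p + (1 / 2) * Matrix.trace (A p * hessZ φ p)

section Linearity

variable {N : ℕ} {f g : ℝ × (Fin N → ℝ) → ℝ}

theorem dtPar_add_const_mul (hf : IsC12 f) (hg : IsC12 g) (c : ℝ) (p : ℝ × (Fin N → ℝ)) :
    dtPar (fun q => f q + c * g q) p = dtPar f p + c * dtPar g p := by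
  have hf' : DifferentiableAt ℝ (fun s => f (s, p.2)) p.1 := hf.2.1 p.2 p.1
  have hg' : DifferentiableAt ℝ (fun s => g (s, p.2)) p.1 := hg.2.1 p.2 p.1
  exact (hf'.hasDerivAt.add (hg'.hasDerivAt.const_mul c)).deriv

theorem IsC12.fderiv_add_const_mul (hf : IsC12 f) (hg : IsC12 g) (c t : ℝ) (y v : Fin N → ℝ) :
    fderiv ℝ (fun x => f (t, x) + c * g (t, x)) y v =
      fderiv ℝ (fun x => f (t, x)) y v + c * fderiv ℝ (fun x => g (t, x)) y v := by
  have hf' : DifferentiableAt ℝ (fun x => f (t, x)) y :=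
    (hf.2.2.2.1 t).differentiable two_ne_zero y
  have hg' : DifferentiableAt ℝ (fun x => g (t, x)) y :=
    (hg.2.2.2.1 t).differentiable two_ne_zero y
  exact DFunLike.congr_fun (hf'.hasFDerivAt.add (hg'.hasFDerivAt.const_mul c)).fderiv v

theorem gradZ_add_const_mul (hf : IsC12 f) (hg : IsC12 g) (c : ℝ) (p : ℝ × (Fin N → ℝ)) :
    gradZ (fun q => f q + c * g q) p = gradZ f p + c • gradZ g p := by
  ext i
  exact hf.fderiv_add_const_mul hg c p.1 p.2 (Pi.single i 1)

theorem IsC12.differentiable_fderiv_apply (hf : IsC12 f) (t : ℝ) (v : Fin N → ℝ) :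
    Differentiable ℝ (fun y => fderiv ℝ (fun x => f (t, x)) y v) := by
  have h : ContDiff ℝ 1 (fderiv ℝ (fun x => f (t, x))) :=
    (hf.2.2.2.1 t).fderiv_right (by norm_num)
  exact (h.differentiable one_ne_zero).clm_apply (differentiable_const v)

theorem hessZ_add_const_mul (hf : IsC12 f) (hg : IsC12 g) (c : ℝ) (p : ℝ × (Fin N → ℝ)) :
    hessZ (fun q => f q + c * g q) p = hessZ f p + c • hessZ g p := by
  ext i j
  have hf' := hf.differentiable_fderiv_apply p.1 (Pi.single j 1) p.2
  have hg' := hg.differentiable_fderiv_apply p.1 (Pi.single j 1) p.2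
  simp only [hessZ, Matrix.of_apply, hf.fderiv_add_const_mul hg, Matrix.add_apply,
    Matrix.smul_apply, smul_eq_mul]
  exact DFunLike.congr_fun (hf'.hasFDerivAt.add (hg'.hasFDerivAt.const_mul c)).fderiv (Pi.single i 1)

theorem IsC12.add_const_mul (hf : IsC12 f) (hg : IsC12 g) (c : ℝ) :
    IsC12 (fun q => f q + c * g q) := by
  refine ⟨hf.1.add (hg.1.const_mul c), fun z => (hf.2.1 z).add ((hg.2.1 z).const_mul c), ?_,
    fun t => (hf.2.2.2.1 t).add (contDiff_const.mul (hg.2.2.2.1 t)), ?_, ?_⟩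
  · rw [funext (dtPar_add_const_mul hf hg c)]
    exact hf.2.2.1.add (hg.2.2.1.const_mul c)
  · rw [funext (gradZ_add_const_mul hf hg c)]
    exact hf.2.2.2.2.1.add (hg.2.2.2.2.1.const_smul c)
  · rw [funext (hessZ_add_const_mul hf hg c)]
    exact hf.2.2.2.2.2.add (hg.2.2.2.2.2.const_smul c)

theorem Lop_add_const_mul (b : ℝ × (Fin N → ℝ) → Fin N → ℝ)
    (A : ℝ × (Fin N → ℝ) → Matrix (Fin N) (Fin N) ℝ)
    (hf : IsC12 f) (hg : IsC12 g) (c : ℝ) (p : ℝ × (Fin N → ℝ)) :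
    Lop b A (fun q => f q + c * g q) p = Lop b A f p + c * Lop b A g p := by
  simp only [Lop, dtPar_add_const_mul hf hg, gradZ_add_const_mul hf hg,
    hessZ_add_const_mul hf hg, dotProduct_add, dotProduct_smul, Matrix.mul_add, Matrix.mul_smul,
    Matrix.trace_add, Matrix.trace_smul, smul_eq_mul]
  ring

end Linearity

/-- A lower semicontinuous function on the strip `[0,T] × ℝ^N` that takes a negative value and is
nonnegative outside a cylinder attains its minimum over the strip. -/
theorem exists_isMinOn_strip {N : ℕ} {T r : ℝ} {w : ℝ × (Fin N → ℝ) → ℝ}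
    (hw : LowerSemicontinuousOn w {q : ℝ × (Fin N → ℝ) | q.1 ∈ Set.Icc 0 T})
    (hout : ∀ q : ℝ × (Fin N → ℝ), q.1 ∈ Set.Icc 0 T → r ≤ ‖q.2‖ → 0 ≤ w q)
    {p : ℝ × (Fin N → ℝ)} (hp : p.1 ∈ Set.Icc 0 T) (hneg : w p < 0) :
    ∃ p₀ : ℝ × (Fin N → ℝ), p₀.1 ∈ Set.Icc 0 T ∧
      IsMinOn w {q : ℝ × (Fin N → ℝ) | q.1 ∈ Set.Icc 0 T} p₀ := by
  let K : Set (ℝ × (Fin N → ℝ)) := Set.Icc 0 T ×ˢ Metric.closedBall 0 r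
  have hK : IsCompact K := isCompact_Icc.prod (isCompact_closedBall 0 r)
  have hpK : p ∈ K := by
    refine ⟨hp, mem_closedBall_zero_iff.2 ?_⟩
    by_contra! h
    exact absurd (hout p hp h.le) (not_le.2 hneg)
  obtain ⟨p₀, hp₀, hmin⟩ := (hw.mono fun q (hq : q ∈ K) => hq.1).exists_isMinOn ⟨p, hpK⟩ hK
  refine ⟨p₀, hp₀.1, fun q hq => ?_⟩
  rcases le_total ‖q.2‖ r with h | h
  · exact hmin ⟨hq, mem_closedBall_zero_iff.2 h⟩
  · exact ((hmin hpK).trans hneg.le).trans (hout q hq h)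

/-- Comparison for the second corrector equation via a strict Lyapunov function
(Step 2 of the proof of Proposition 7.2): given a nonnegative `C^{1,2}` function `χ` with
`−ℒχ > 0` on `[0,T) × ℝ^N`, a `C^{1,2}` classical solution `ũ` of `−ℒũ = a`, and a lower
semicontinuous viscosity supersolution `u₁` of the same equation dominating `ũ` at the
terminal time and satisfying a joint growth condition relative to `χ`, one has `u₁ ≥ ũ`
on all of `[0,T] × ℝ^N`. -/
theorem second_corrector_comparison {N : ℕ} (hN : 1 ≤ N) (T : ℝ) (hT : 0 < T)
    (b : ℝ × (Fin N → ℝ) → Fin N → ℝ) (hb : Continuous b)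
    (A : ℝ × (Fin N → ℝ) → Matrix (Fin N) (Fin N) ℝ) (hA : Continuous A)
    (hAsymm : ∀ p, (A p).IsSymm)
    (a : ℝ × (Fin N → ℝ) → ℝ) (ha : Continuous a)
    -- (i) strict Lyapunov function
    (χ : ℝ × (Fin N → ℝ) → ℝ) (hχC : IsC12 χ)
    (hχnonneg : ∀ p : ℝ × (Fin N → ℝ), p.1 ∈ Set.Icc 0 T → 0 ≤ χ p)
    (hχstrict : ∀ p : ℝ × (Fin N → ℝ), p.1 ∈ Set.Ico 0 T → 0 < -Lop b A χ p)
    -- (ii) classical solution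
    (uTilde : ℝ × (Fin N → ℝ) → ℝ) (huTildeC : IsC12 uTilde)
    (huTildeSol : ∀ p : ℝ × (Fin N → ℝ), p.1 ∈ Set.Ico 0 T → -Lop b A uTilde p = a p)
    -- (iii) lower semicontinuous viscosity supersolution
    (u₁ : ℝ × (Fin N → ℝ) → ℝ)
    (hu₁lsc : LowerSemicontinuousOn u₁ {p : ℝ × (Fin N → ℝ) | p.1 ∈ Set.Icc 0 T})
    (hu₁super : ∀ ψ : ℝ × (Fin N → ℝ) → ℝ, IsC12 ψ →
      ∀ p : ℝ × (Fin N → ℝ), p.1 ∈ Set.Ico 0 T →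
        IsLocalMinOn (fun q => u₁ q - ψ q) {q : ℝ × (Fin N → ℝ) | q.1 ∈ Set.Icc 0 T} p →
        a p ≤ -Lop b A ψ p)
    -- (iv) growth condition
    (hgrowth : ∀ δ : ℝ, 0 < δ → ∃ r : ℝ, 0 < r ∧ ∀ p : ℝ × (Fin N → ℝ),
      p.1 ∈ Set.Icc 0 T → r ≤ ‖p.2‖ → |u₁ p| + |uTilde p| ≤ δ * (1 + χ p))
    -- (v) terminal condition
    (hterminal : ∀ z : Fin N → ℝ, uTilde (T, z) ≤ u₁ (T, z)) :
    ∀ p : ℝ × (Fin N → ℝ), p.1 ∈ Set.Icc 0 T → uTilde p ≤ u₁ p := by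
  intro p hp
  by_contra! hlt
  obtain ⟨ε, hε, hεp⟩ : ∃ ε : ℝ, 0 < ε ∧ ε * (1 + χ p) < uTilde p - u₁ p := by
    have hpos : 0 < 1 + χ p := by linarith [hχnonneg p hp]
    obtain ⟨ε, hε, h⟩ := exists_between (div_pos (sub_pos.2 hlt) hpos)
    exact ⟨ε, hε, (lt_div_iff₀ hpos).1 h⟩
  obtain ⟨r, -, hr⟩ := hgrowth ε hε
  let w : ℝ × (Fin N → ℝ) → ℝ := fun q => u₁ q + (ε * (1 + χ q) - uTilde q)
  have hw : LowerSemicontinuousOn w {q : ℝ × (Fin N → ℝ) | q.1 ∈ Set.Icc 0 T} := by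
    have hcont : Continuous fun q => ε * (1 + χ q) - uTilde q :=
      ((continuous_const.add hχC.1).const_mul ε).sub huTildeC.1
    exact hu₁lsc.add (hcont.lowerSemicontinuous.lowerSemicontinuousOn _)
  have hout : ∀ q : ℝ × (Fin N → ℝ), q.1 ∈ Set.Icc 0 T → r ≤ ‖q.2‖ → 0 ≤ w q := by
    intro q hq hqr
    dsimp only [w]
    linarith [hr q hq hqr, neg_abs_le (u₁ q), le_abs_self (uTilde q)]
  have hneg : w p < 0 := by
    dsimp only [w]
    linarith
  obtain ⟨p₀, hp₀, hmin⟩ := exists_isMinOn_strip hw hout hp hneg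
  have hp₀T : p₀.1 ∈ Set.Ico 0 T := by
    refine ⟨hp₀.1, hp₀.2.lt_of_ne fun h => ?_⟩
    have hle : w p₀ ≤ w p := hmin hp
    have hterm : uTilde p₀ ≤ u₁ p₀ := by
      have := hterminal p₀.2
      rwa [← h] at this
    have hχε : 0 ≤ ε * (1 + χ p₀) := mul_nonneg hε.le (by linarith [hχnonneg p₀ hp₀])
    have : 0 ≤ w p₀ := by
      dsimp only [w]
      linarith
    linarith
  have hloc : IsLocalMinOn (fun q => u₁ q - (uTilde q + -ε * χ q))
      {q : ℝ × (Fin N → ℝ) | q.1 ∈ Set.Icc 0 T} p₀ := by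
    refine IsMinOn.localize fun q hq => ?_
    have hle : w p₀ ≤ w q := hmin hq
    dsimp only [w] at hle
    change u₁ p₀ - (uTilde p₀ + -ε * χ p₀) ≤ u₁ q - (uTilde q + -ε * χ q)
    linarith
  have hsuper := hu₁super _ (huTildeC.add_const_mul hχC (-ε)) p₀ hp₀T hloc
  rw [Lop_add_const_mul b A huTildeC hχC] at hsuper
  linarith [huTildeSol p₀ hp₀T, mul_pos hε (hχstrict p₀ hp₀T)]
end

section
/- (Deterministic L² bound on the deviation from the frictionless target; from the proof of Theorem 8.1.) Let t < T be reals, C > 0, ε > 0, M ≥ 0 and δ₀ ∈ ℝ. Let κ : [t,T] → ℝ be continuous with κ(s) ≥ C/ε² for all s ∈ [t,T], and let h : [t,T] → ℝ be continuous with |h(s)| ≤ M for all s. Define δ(r) := e^{−∫ₜʳ κ(u)du}·δ₀ + ∫ₜʳ e^{−∫ₛʳ κ(u)du} h(s) ds for r ∈ [t,T]. Then (1/ε²)·∫ₜᵀ δ(r)² dr ≤ δ₀²/C + 2M²(T−t)²/C. -/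
/-- A lower bound `l` on the mean-reversion speed gives exponential decay at rate `l`. -/
lemma exp_neg_integral_le {κ : ℝ → ℝ} {s r l : ℝ} (hsr : s ≤ r)
    (hκc : ContinuousOn κ (Set.Icc s r)) (hκ : ∀ u ∈ Set.Icc s r, l ≤ κ u) :
    Real.exp (-∫ u in s..r, κ u) ≤ Real.exp (-(l * (r - s))) := by
  have h := intervalIntegral.integral_mono_on hsr (intervalIntegrable_const (μ := MeasureTheory.volume)
    (c := l)) (hκc.intervalIntegrable_of_Icc hsr) hκ
  rw [intervalIntegral.integral_const, smul_eq_mul] at h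
  exact Real.exp_le_exp.mpr (by linarith)

/-- The exponentially discounted contribution of a drift bounded by `M`. -/
lemma abs_integral_exp_mul_le {κ h : ℝ → ℝ} {t r l M : ℝ} (htr : t ≤ r) (hl : 0 < l)
    (hκc : ContinuousOn κ (Set.Icc t r)) (hκ : ∀ u ∈ Set.Icc t r, l ≤ κ u)
    (hh : ∀ s ∈ Set.Icc t r, |h s| ≤ M) :
    |∫ s in t..r, Real.exp (-∫ u in s..r, κ u) * h s|
      ≤ M * ((1 - Real.exp (-(l * (r - t)))) / l) := by
  have hderiv : ∀ s ∈ Set.uIcc t r, HasDerivAt (fun s => M * (Real.exp (-(l * (r - s))) / l))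
      (Real.exp (-(l * (r - s))) * M) s := by
    intro s _
    have h1 : HasDerivAt (fun s : ℝ => -(l * (r - s))) (-(l * -1)) s :=
      (((hasDerivAt_id s).const_sub r).const_mul l).neg
    refine ((h1.exp.div_const l).const_mul M).congr_deriv ?_
    field_simp
  have hint : IntervalIntegrable (fun s => Real.exp (-(l * (r - s))) * M)
      MeasureTheory.volume t r :=
    Continuous.intervalIntegrable (by fun_prop) t r
  have heq := intervalIntegral.integral_eq_sub_of_hasDerivAt hderiv hint
  rw [← Real.norm_eq_abs]
  refine (intervalIntegral.norm_integral_le_of_norm_le htr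
    (Filter.Eventually.of_forall fun s hs => ?_) hint).trans (le_of_eq ?_)
  · rw [norm_mul, Real.norm_eq_abs, Real.norm_eq_abs, Real.abs_exp]
    have hsub : Set.Icc s r ⊆ Set.Icc t r := Set.Icc_subset_Icc_left hs.1.le
    exact mul_le_mul
      (exp_neg_integral_le hs.2 (hκc.mono hsub) fun u hu => hκ u (hsub hu))
      (hh s (Set.Ioc_subset_Icc_self hs)) (abs_nonneg _) (Real.exp_pos _).le
  · rw [heq]
    simp
    ring

lemma sq_one_sub_exp_neg_div_le {l x : ℝ} (hl : 0 < l) (hx : 0 ≤ x) :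
    ((1 - Real.exp (-(l * x))) / l) ^ 2 ≤ x / l := by
  have h0 : Real.exp (-(l * x)) ≤ 1 := Real.exp_le_one_iff.mpr (by nlinarith)
  have h1 := Real.add_one_le_exp (-(l * x))
  have h2 := Real.exp_pos (-(l * x))
  rw [div_pow, div_le_div_iff₀ (by positivity) hl]
  have h3 : (1 - Real.exp (-(l * x))) ^ 2 ≤ l * x := by nlinarith
  nlinarith [mul_le_mul_of_nonneg_right h3 hl.le]

lemma integral_deviation_bound_le {t T l a M : ℝ} (hl : 0 < l) :
    ∫ r in t..T, (2 * a ^ 2 * Real.exp (-(2 * l * (r - t))) + 2 * M ^ 2 * ((r - t) / l))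
      ≤ (a ^ 2 + M ^ 2 * (T - t) ^ 2) / l := by
  have hderiv : ∀ r ∈ Set.uIcc t T, HasDerivAt
      (fun r => -(a ^ 2 / l) * Real.exp (-(2 * l * (r - t))) + M ^ 2 / l * (r - t) ^ 2)
      (2 * a ^ 2 * Real.exp (-(2 * l * (r - t))) + 2 * M ^ 2 * ((r - t) / l)) r := by
    intro r _
    have h0 : HasDerivAt (fun r : ℝ => r - t) 1 r := (hasDerivAt_id r).sub_const t
    have h1 : HasDerivAt (fun r : ℝ => -(2 * l * (r - t))) (-(2 * l * 1)) r :=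
      (h0.const_mul (2 * l)).neg
    refine ((h1.exp.const_mul (-(a ^ 2 / l))).add ((h0.pow 2).const_mul (M ^ 2 / l))).congr_deriv ?_
    field_simp
    ring
  rw [intervalIntegral.integral_eq_sub_of_hasDerivAt hderiv
    (Continuous.intervalIntegrable (by fun_prop) t T)]
  have : 0 ≤ a ^ 2 / l * Real.exp (-(2 * l * (T - t))) := by positivity
  simp only [sub_self, mul_zero, neg_zero, Real.exp_zero]
  ring_nf at this ⊢
  linarith

/-- Deterministic `L²` bound on the deviation from the frictionless target (from the proof
of Theorem 8.1): if `κ ≥ C/ε²` on `[t,T]`, `|h| ≤ M` on `[t,T]`, and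
`δ(r) = e^{−∫ₜʳ κ} δ₀ + ∫ₜʳ e^{−∫ₛʳ κ} h(s) ds`, then
`(1/ε²) ∫ₜᵀ δ(r)² dr ≤ δ₀²/C + 2M²(T−t)²/C`. -/
theorem deviation_L2_bound (t T : ℝ) (ht : t < T) (C ε M δ₀ : ℝ)
    (hC : 0 < C) (hε : 0 < ε) (hM : 0 ≤ M)
    (κ h : ℝ → ℝ)
    (hκc : ContinuousOn κ (Set.Icc t T)) (hκ : ∀ s ∈ Set.Icc t T, C / ε ^ 2 ≤ κ s)
    (hhc : ContinuousOn h (Set.Icc t T)) (hh : ∀ s ∈ Set.Icc t T, |h s| ≤ M)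
    (δ : ℝ → ℝ)
    (hδ : ∀ r, δ r = Real.exp (-∫ u in t..r, κ u) * δ₀
      + ∫ s in t..r, Real.exp (-∫ u in s..r, κ u) * h s) :
    (1 / ε ^ 2) * ∫ r in t..T, (δ r) ^ 2 ≤ δ₀ ^ 2 / C + 2 * M ^ 2 * (T - t) ^ 2 / C := by
  have hl : 0 < C / ε ^ 2 := by positivity
  have hpt : ∀ r ∈ Set.Icc t T, δ r ^ 2 ≤
      2 * δ₀ ^ 2 * Real.exp (-(2 * (C / ε ^ 2) * (r - t)))
        + 2 * M ^ 2 * ((r - t) / (C / ε ^ 2)) := by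
    intro r hr
    have hsub : Set.Icc t r ⊆ Set.Icc t T := Set.Icc_subset_Icc_right hr.2
    have hexp := exp_neg_integral_le hr.1 (hκc.mono hsub) fun u hu => hκ u (hsub hu)
    have hdrift := abs_integral_exp_mul_le hr.1 hl (hκc.mono hsub) (fun u hu => hκ u (hsub hu))
      fun s hs => hh s (hsub hs)
    have hinit : (Real.exp (-∫ u in t..r, κ u) * δ₀) ^ 2
        ≤ δ₀ ^ 2 * Real.exp (-(2 * (C / ε ^ 2) * (r - t))) := by
      have hsq : Real.exp (-(2 * (C / ε ^ 2) * (r - t)))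
          = Real.exp (-(C / ε ^ 2 * (r - t))) ^ 2 := by
        rw [← Real.exp_nat_mul]
        congr 1
        push_cast
        ring
      rw [mul_pow, mul_comm, hsq]
      gcongr
    have hdrift_sq : (∫ s in t..r, Real.exp (-∫ u in s..r, κ u) * h s) ^ 2
        ≤ M ^ 2 * ((r - t) / (C / ε ^ 2)) := by
      rw [← sq_abs]
      calc _ ≤ _ := pow_le_pow_left₀ (abs_nonneg _) hdrift 2
        _ ≤ _ := by
          rw [mul_pow]
          exact mul_le_mul_of_nonneg_left
            (sq_one_sub_exp_neg_div_le hl (sub_nonneg.mpr hr.1)) (sq_nonneg M)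
    rw [hδ r]
    refine add_sq_le.trans ?_
    linarith
  have hmono : ∫ r in t..T, δ r ^ 2 ≤ ∫ r in t..T,
      (2 * δ₀ ^ 2 * Real.exp (-(2 * (C / ε ^ 2) * (r - t)))
        + 2 * M ^ 2 * ((r - t) / (C / ε ^ 2))) := by
    rw [intervalIntegral.integral_of_le ht.le, intervalIntegral.integral_of_le ht.le]
    refine MeasureTheory.integral_mono_of_nonneg
      (Filter.Eventually.of_forall fun r => sq_nonneg (δ r)) ?_ ?_
    · exact (Continuous.intervalIntegrable (by fun_prop) t T).1
    · filter_upwards [MeasureTheory.ae_restrict_mem measurableSet_Ioc] with r hr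
      exact hpt r (Set.Ioc_subset_Icc_self hr)
  calc (1 / ε ^ 2) * ∫ r in t..T, δ r ^ 2
      ≤ (1 / ε ^ 2) * ((δ₀ ^ 2 + M ^ 2 * (T - t) ^ 2) / (C / ε ^ 2)) := by
        gcongr
        exact hmono.trans (integral_deviation_bound_le hl)
    _ = δ₀ ^ 2 / C + M ^ 2 * (T - t) ^ 2 / C := by field_simp
    _ ≤ δ₀ ^ 2 / C + 2 * M ^ 2 * (T - t) ^ 2 / C := by
        gcongr
        nlinarith [sq_nonneg M]
end

section
/- (Smooth cutoff functions with small radial gradient; the bump-function construction (6.28) adapted from Possamaï–Soner–Touzi, used in the proof of Proposition 6.10.) For every dimension d ≥ 1 there exists a constant C* > 0 such that for every η ∈ (0,1] there exist a real number a_η > 1 and an infinitely differentiable function h : ℝ^d → [0,1] satisfying: h(x) = 1 for every x in the closed unit ball; h(x) = 0 for every x outside the closed ball of radius a_η centered at the origin; |x|·|∇h(x)| ≤ η for every x ∈ ℝ^d; and |x|²·‖D²h(x)‖ ≤ C* for every x ∈ ℝ^d, where D²h denotes the Hessian of h and ‖·‖ the operator norm. -/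
/-- The first derivative of the smooth transition function is compactly supported. -/
lemma hasCompactSupport_deriv_smoothTransition :
    HasCompactSupport (deriv Real.smoothTransition) := by
  refine HasCompactSupport.of_support_subset_isCompact (isCompact_Icc (a := (0 : ℝ)) (b := 1)) ?_
  intro t ht
  by_contra hmem
  apply ht
  rw [Set.mem_Icc, not_and_or, not_le, not_le] at hmem
  rcases hmem with h | h
  · have : Real.smoothTransition =ᶠ[nhds t] fun _ => (0 : ℝ) := by
      filter_upwards [Iio_mem_nhds h] with s hs
      exact Real.smoothTransition.zero_of_nonpos (le_of_lt hs)
    simpa using this.deriv_eq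
  · have : Real.smoothTransition =ᶠ[nhds t] fun _ => (1 : ℝ) := by
      filter_upwards [Ioi_mem_nhds h] with s hs
      exact Real.smoothTransition.one_of_one_le (le_of_lt hs)
    simpa using this.deriv_eq

/-- The first two derivatives of the smooth transition function are bounded. -/
lemma exists_bound_deriv_smoothTransition :
    ∃ M : ℝ, 1 ≤ M ∧ (∀ t, |deriv Real.smoothTransition t| ≤ M) ∧
      ∀ t, |deriv (deriv Real.smoothTransition) t| ≤ M := by
  have hS : ContDiff ℝ 2 Real.smoothTransition := Real.smoothTransition.contDiff
  have hS' : ContDiff ℝ 1 (deriv Real.smoothTransition) := hS.deriv' (n := 1)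
  obtain ⟨A, hA⟩ := hasCompactSupport_deriv_smoothTransition.exists_bound_of_continuous
    hS'.continuous
  obtain ⟨B, hB⟩ := hasCompactSupport_deriv_smoothTransition.deriv.exists_bound_of_continuous
    (hS'.continuous_deriv le_rfl)
  refine ⟨max 1 (max A B), le_max_left _ _, fun t => ?_, fun t => ?_⟩
  · exact (hA t).trans ((le_max_left _ _).trans (le_max_right _ _))
  · exact (hB t).trans ((le_max_right _ _).trans (le_max_right _ _))

section LogCutoff

variable {E : Type*} [NormedAddCommGroup E]

/-- The radial cutoff equal to `1` on the unit ball and decaying to `0` logarithmically slowly,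
at a rate `c`. -/
noncomputable def logCutoff (c : ℝ) (x : E) : ℝ :=
  Real.smoothTransition (1 - c * Real.log (‖x‖ ^ 2))

lemma logCutoff_eq_one {c : ℝ} (hc : 0 ≤ c) {x : E} (hx : ‖x‖ ≤ 1) : logCutoff c x = 1 := by
  apply Real.smoothTransition.one_of_one_le
  have : Real.log (‖x‖ ^ 2) ≤ 0 :=
    Real.log_nonpos (by positivity) (pow_le_one₀ (norm_nonneg x) hx)
  nlinarith

lemma logCutoff_eq_zero {c : ℝ} (hc : 0 < c) {x : E} (hx : Real.exp (1 / (2 * c)) < ‖x‖) :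
    logCutoff c x = 0 := by
  apply Real.smoothTransition.zero_of_nonpos
  have hpos : 0 < ‖x‖ := (Real.exp_pos _).trans hx
  have h : 1 / (2 * c) < Real.log ‖x‖ := (Real.lt_log_iff_exp_lt hpos).2 hx
  rw [div_lt_iff₀ (by positivity)] at h
  rw [Real.log_pow]
  push_cast
  linarith

lemma logCutoff_eventuallyEq_one {c : ℝ} (hc : 0 ≤ c) :
    logCutoff c =ᶠ[nhds (0 : E)] fun _ => (1 : ℝ) := by
  filter_upwards [Metric.ball_mem_nhds (0 : E) one_pos] with y hy
  exact logCutoff_eq_one hc (mem_ball_zero_iff.1 hy).le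

variable [InnerProductSpace ℝ E]

lemma contDiff_logCutoff {c : ℝ} (hc : 0 ≤ c) : ContDiff ℝ (⊤ : ℕ∞) (logCutoff c : E → ℝ) := by
  rw [contDiff_iff_contDiffAt]
  intro x
  by_cases hx : x = 0
  · subst hx
    exact contDiffAt_const.congr_of_eventuallyEq (logCutoff_eventuallyEq_one hc)
  · have hne : ‖x‖ ^ 2 ≠ 0 := by simpa using hx
    have hinner : ContDiffAt ℝ (⊤ : ℕ∞) (fun y : E => 1 - c * Real.log (‖y‖ ^ 2)) x :=
      contDiffAt_const.sub
        (contDiffAt_const.mul (((contDiff_norm_sq ℝ).contDiffAt).log hne))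
    exact Real.smoothTransition.contDiffAt.comp x hinner

/-- The factor of `x` in the gradient of `logCutoff c`, as a function of `‖x‖ ^ 2`. -/
noncomputable def logCutoffSlope (c s : ℝ) : ℝ :=
  -2 * c * deriv Real.smoothTransition (1 - c * Real.log s) / s

lemma hasDerivAt_one_sub_mul_log (c : ℝ) {s : ℝ} (hs : s ≠ 0) :
    HasDerivAt (fun s => 1 - c * Real.log s) (-(c * s⁻¹)) s :=
  ((Real.hasDerivAt_log hs).const_mul c).const_sub 1

lemma hasGradientAt_logCutoff [CompleteSpace E] {c : ℝ} (hc : 0 ≤ c) (x : E) :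
    HasGradientAt (logCutoff c) (logCutoffSlope c (‖x‖ ^ 2) • x) x := by
  by_cases hx : x = 0
  · subst hx
    rw [smul_zero]
    exact (hasGradientAt_const (0 : E) (1 : ℝ)).congr_of_eventuallyEq
      (logCutoff_eventuallyEq_one hc)
  · have hne : ‖x‖ ^ 2 ≠ 0 := by simpa using hx
    have hS : HasDerivAt Real.smoothTransition
        (deriv Real.smoothTransition (1 - c * Real.log (‖x‖ ^ 2)))
        (1 - c * Real.log (‖x‖ ^ 2)) :=
      ((Real.smoothTransition.contDiff (n := 1)).differentiable one_ne_zero _).hasDerivAt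
    have h1 := (hS.comp (‖x‖ ^ 2) (hasDerivAt_one_sub_mul_log c hne)).comp_hasFDerivAt x
      (hasStrictFDerivAt_norm_sq x).hasFDerivAt
    rw [hasGradientAt_iff_hasFDerivAt]
    refine h1.congr_fderiv ?_
    ext v
    simp [logCutoffSlope]
    field_simp

lemma hasDerivAt_logCutoffSlope (c : ℝ) {s : ℝ} (hs : s ≠ 0) :
    HasDerivAt (logCutoffSlope c)
      ((2 * c ^ 2 * deriv (deriv Real.smoothTransition) (1 - c * Real.log s) +
        2 * c * deriv Real.smoothTransition (1 - c * Real.log s)) / s ^ 2) s := by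
  have hS' : ContDiff ℝ 1 (deriv Real.smoothTransition) :=
    (Real.smoothTransition.contDiff (n := 2)).deriv' (n := 1)
  have hd : HasDerivAt (deriv Real.smoothTransition)
      (deriv (deriv Real.smoothTransition) (1 - c * Real.log s)) (1 - c * Real.log s) :=
    (hS'.differentiable one_ne_zero _).hasDerivAt
  have h := ((hd.comp s (hasDerivAt_one_sub_mul_log c hs)).const_mul (-2 * c)).div
    (hasDerivAt_id s) hs
  refine h.congr_deriv ?_
  simp only [id, Function.comp]
  field_simp
  ring

variable {c M : ℝ}

lemma mul_abs_logCutoffSlope_le (hc : 0 ≤ c)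
    (hM : ∀ t, |deriv Real.smoothTransition t| ≤ M) {s : ℝ} (hs : 0 < s) :
    s * |logCutoffSlope c s| ≤ 2 * c * M := by
  have : s * |logCutoffSlope c s| =
      2 * c * |deriv Real.smoothTransition (1 - c * Real.log s)| := by
    simp only [logCutoffSlope, abs_div, abs_mul, abs_neg, abs_of_pos hs, abs_of_nonneg hc, abs_two]
    field_simp
  rw [this]
  exact mul_le_mul_of_nonneg_left (hM _) (by positivity)

lemma sq_mul_abs_deriv_logCutoffSlope_le (hc : 0 ≤ c)
    (hM : ∀ t, |deriv Real.smoothTransition t| ≤ M)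
    (hM' : ∀ t, |deriv (deriv Real.smoothTransition) t| ≤ M) {s : ℝ} (hs : 0 < s) :
    s ^ 2 * |deriv (logCutoffSlope c) s| ≤ 2 * c ^ 2 * M + 2 * c * M := by
  rw [(hasDerivAt_logCutoffSlope c hs.ne').deriv, abs_div, abs_of_pos (pow_pos hs 2),
    mul_div_cancel₀ _ (pow_pos hs 2).ne']
  refine (abs_add_le _ _).trans (add_le_add ?_ ?_)
  · rw [abs_mul, abs_of_nonneg (by positivity)]
    exact mul_le_mul_of_nonneg_left (hM' _) (by positivity)
  · rw [abs_mul, abs_of_nonneg (by positivity)]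
    exact mul_le_mul_of_nonneg_left (hM _) (by positivity)

lemma norm_mul_norm_gradient_logCutoff_le [CompleteSpace E] (hc : 0 ≤ c) (hM0 : 0 ≤ M)
    (hM : ∀ t, |deriv Real.smoothTransition t| ≤ M) (x : E) :
    ‖x‖ * ‖gradient (logCutoff c) x‖ ≤ 2 * c * M := by
  by_cases hx : x = 0
  · subst hx
    rw [norm_zero, zero_mul]
    positivity
  · rw [(hasGradientAt_logCutoff hc x).gradient, norm_smul, Real.norm_eq_abs]
    have := mul_abs_logCutoffSlope_le hc hM (s := ‖x‖ ^ 2) (by positivity)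
    linarith

lemma sq_norm_mul_norm_fderiv_gradient_logCutoff_le [CompleteSpace E] (hc : 0 ≤ c) (hM0 : 0 ≤ M)
    (hM : ∀ t, |deriv Real.smoothTransition t| ≤ M)
    (hM' : ∀ t, |deriv (deriv Real.smoothTransition) t| ≤ M) (x : E) :
    ‖x‖ ^ 2 * ‖fderiv ℝ (fun y => gradient (logCutoff c) y) x‖ ≤ 4 * c ^ 2 * M + 6 * c * M := by
  by_cases hx : x = 0
  · subst hx
    rw [norm_zero, zero_pow two_ne_zero, zero_mul]
    positivity
  have hpos : 0 < ‖x‖ ^ 2 := by positivity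
  have hgrad : (fun y : E => gradient (logCutoff c) y) =
      fun y => logCutoffSlope c (‖y‖ ^ 2) • y :=
    funext fun y => (hasGradientAt_logCutoff hc y).gradient
  have hslope : HasFDerivAt (fun y : E => logCutoffSlope c (‖y‖ ^ 2))
      (deriv (logCutoffSlope c) (‖x‖ ^ 2) • (2 • innerSL ℝ x)) x :=
    (hasDerivAt_logCutoffSlope c hpos.ne').differentiableAt.hasDerivAt.comp_hasFDerivAt
      (f := fun y : E => ‖y‖ ^ 2) x (hasStrictFDerivAt_norm_sq x).hasFDerivAt
  have hbound : ‖fderiv ℝ (fun y => gradient (logCutoff c) y) x‖ ≤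
      |logCutoffSlope c (‖x‖ ^ 2)| + 2 * ‖x‖ ^ 2 * |deriv (logCutoffSlope c) (‖x‖ ^ 2)| := by
    rw [hgrad, (hslope.fun_smul (f := fun y => y) (hasFDerivAt_id x)).fderiv]
    refine ContinuousLinearMap.opNorm_le_bound _ (by positivity) fun v => ?_
    have hin : |inner ℝ x v| ≤ ‖x‖ * ‖v‖ := abs_real_inner_le_norm x v
    calc _ ≤ |logCutoffSlope c (‖x‖ ^ 2)| * ‖v‖ +
          |deriv (logCutoffSlope c) (‖x‖ ^ 2)| * (2 * |inner ℝ x v|) * ‖x‖ := by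
          refine (norm_add_le _ _).trans (le_of_eq ?_)
          simp [norm_smul]
      _ ≤ |logCutoffSlope c (‖x‖ ^ 2)| * ‖v‖ +
          |deriv (logCutoffSlope c) (‖x‖ ^ 2)| * (2 * (‖x‖ * ‖v‖)) * ‖x‖ := by gcongr
      _ = _ := by ring
  have h1 := mul_abs_logCutoffSlope_le hc hM hpos
  have h2 := sq_mul_abs_deriv_logCutoffSlope_le hc hM hM' hpos
  have h3 := mul_le_mul_of_nonneg_left hbound hpos.le
  linarith

end LogCutoff

/-- Smooth cutoff functions with small radial gradient (the bump-function construction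
(6.28) adapted from Possamaï–Soner–Touzi): for every dimension `d ≥ 1` there is a constant
`C* > 0` such that for every `η ∈ (0,1]` there exist `a_η > 1` and a smooth
`h : ℝ^d → [0,1]` with `h = 1` on the closed unit ball, `h = 0` outside the closed ball of
radius `a_η`, `|x| |∇h(x)| ≤ η`, and `|x|² ‖D²h(x)‖ ≤ C*` everywhere. -/
theorem smooth_cutoff_small_radial_gradient (d : ℕ) (hd : 1 ≤ d) :
    ∃ Cstar : ℝ, 0 < Cstar ∧
      ∀ η : ℝ, η ∈ Set.Ioc (0 : ℝ) 1 →
        ∃ a : ℝ, 1 < a ∧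
          ∃ h : EuclideanSpace ℝ (Fin d) → ℝ,
            ContDiff ℝ (⊤ : ℕ∞) h ∧
            (∀ x, h x ∈ Set.Icc (0 : ℝ) 1) ∧
            (∀ x, ‖x‖ ≤ 1 → h x = 1) ∧
            (∀ x, a < ‖x‖ → h x = 0) ∧
            (∀ x, ‖x‖ * ‖gradient h x‖ ≤ η) ∧
            (∀ x, ‖x‖ ^ 2 * ‖fderiv ℝ (fun y => gradient h y) x‖ ≤ Cstar) := by
  obtain ⟨M, hM1, hM, hM'⟩ := exists_bound_deriv_smoothTransition
  have hM0 : 0 < M := one_pos.trans_le hM1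
  refine ⟨4, by norm_num, ?_⟩
  rintro η ⟨hη0, hη1⟩
  have hc : 0 < η / (2 * M) := by positivity
  have hcM : 2 * (η / (2 * M)) * M = η := by field_simp
  have hc1 : η / (2 * M) ≤ 1 / 2 := by
    rw [div_le_iff₀ (by positivity)]
    linarith
  refine ⟨Real.exp (1 / (2 * (η / (2 * M)))), Real.one_lt_exp_iff.2 (by positivity),
    logCutoff (η / (2 * M)), contDiff_logCutoff hc.le,
    fun x => ⟨Real.smoothTransition.nonneg _, Real.smoothTransition.le_one _⟩,
    fun x hx => logCutoff_eq_one hc.le hx, fun x hx => logCutoff_eq_zero hc hx,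
    fun x => ?_, fun x => ?_⟩
  · exact (norm_mul_norm_gradient_logCutoff_le hc.le hM0.le hM x).trans_eq hcM
  · refine (sq_norm_mul_norm_fderiv_gradient_logCutoff_le hc.le hM0.le hM hM' x).trans ?_
    nlinarith
end
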